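/- The proof system ⊢₀ together with the (Cases) rule is complete for L2: if Γ ⊨ φ, then Γ ⊢ φ. -/

import Mathlib

inductive Tm (P R : Type) : Type
  | noun : P → Tm P R
  | allT : R → Tm P R → Tm P R

inductive Sent (P R : Type) : Type
  | allS : Tm P R → Tm P R → Sent P R
  | someS : Tm P R → Tm P R → Sent P R

structure Model (P R : Type) where
  W : Type
  nounI : P → Set W
  verbI : R → W → W → Prop

def Tm.interp {P R : Type} (M : Model P R) : Tm P R → Set M.W
  | .noun p => M.nounI p
  | .allT r x => {m | ∀ n ∈ Tm.interp M x, M.verbI r m n}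

def Model.sat {P R : Type} (M : Model P R) : Sent P R → Prop
  | .allS x y => Tm.interp M x ⊆ Tm.interp M y
  | .someS x y => (Tm.interp M x ∩ Tm.interp M y).Nonempty

def entails {P R : Type} (Γ : Set (Sent P R)) (φ : Sent P R) : Prop :=
  ∀ M : Model P R, (∀ ψ ∈ Γ, M.sat ψ) → M.sat φ

inductive Proves0 {P R : Type} (Γ : Set (Sent P R)) : Sent P R → Prop
  | hyp {φ} : φ ∈ Γ → Proves0 Γ φ
  | ax (x : Tm P R) : Proves0 Γ (Sent.allS x x)
  | barbara {x y z} : Proves0 Γ (Sent.allS x y) → Proves0 Γ (Sent.allS y z) →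
      Proves0 Γ (Sent.allS x z)
  | anti {x y} (r : R) : Proves0 Γ (Sent.allS x y) →
      Proves0 Γ (Sent.allS (Tm.allT r y) (Tm.allT r x))
  | some1 {x y} : Proves0 Γ (Sent.someS x y) → Proves0 Γ (Sent.someS x x)
  | some2 {x y} : Proves0 Γ (Sent.someS x y) → Proves0 Γ (Sent.someS y x)
  | darii {x y z} : Proves0 Γ (Sent.someS x y) → Proves0 Γ (Sent.allS y z) →
      Proves0 Γ (Sent.someS x z)

/-- The proof relation ⊢ : the rules of ⊢₀ together with the (Cases) rule, which
allows withdrawing the assumptions (some x x) and (all y (r all x)) respectively. -/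
inductive ProvesC {P R : Type} : Set (Sent P R) → Sent P R → Prop
  | hyp {Γ : Set (Sent P R)} {φ} : φ ∈ Γ → ProvesC Γ φ
  | ax {Γ : Set (Sent P R)} (x : Tm P R) : ProvesC Γ (Sent.allS x x)
  | barbara {Γ : Set (Sent P R)} {x y z} :
      ProvesC Γ (Sent.allS x y) → ProvesC Γ (Sent.allS y z) → ProvesC Γ (Sent.allS x z)
  | anti {Γ : Set (Sent P R)} {x y} (r : R) :
      ProvesC Γ (Sent.allS x y) → ProvesC Γ (Sent.allS (Tm.allT r y) (Tm.allT r x))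
  | some1 {Γ : Set (Sent P R)} {x y} :
      ProvesC Γ (Sent.someS x y) → ProvesC Γ (Sent.someS x x)
  | some2 {Γ : Set (Sent P R)} {x y} :
      ProvesC Γ (Sent.someS x y) → ProvesC Γ (Sent.someS y x)
  | darii {Γ : Set (Sent P R)} {x y z} :
      ProvesC Γ (Sent.someS x y) → ProvesC Γ (Sent.allS y z) → ProvesC Γ (Sent.someS x z)
  | cases {Γ : Set (Sent P R)} {φ} (x y : Tm P R) (r : R) :
      ProvesC (insert (Sent.someS x x) Γ) φ →
      ProvesC (insert (Sent.allS y (Tm.allT r x)) Γ) φ →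
      ProvesC Γ φ


theorem ProvesC.weaken {P R : Type} {Γ : Set (Sent P R)} {φ : Sent P R}
    (h : ProvesC Γ φ) : ∀ {Δ : Set (Sent P R)}, Γ ⊆ Δ → ProvesC Δ φ := by
  induction h with
  | hyp h => intro Δ hs; exact .hyp (hs h)
  | ax x => intro Δ hs; exact .ax x
  | barbara _ _ i1 i2 => intro Δ hs; exact .barbara (i1 hs) (i2 hs)
  | anti r _ i => intro Δ hs; exact .anti r (i hs)
  | some1 _ i => intro Δ hs; exact .some1 (i hs)
  | some2 _ i => intro Δ hs; exact .some2 (i hs)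
  | darii _ _ i1 i2 => intro Δ hs; exact .darii (i1 hs) (i2 hs)
  | cases x y r _ _ i1 i2 =>
    intro Δ hs
    exact .cases x y r (i1 (Set.insert_subset_insert hs)) (i2 (Set.insert_subset_insert hs))

theorem ProvesC.finitary {P R : Type} {Γ : Set (Sent P R)} {φ : Sent P R}
    (h : ProvesC Γ φ) : ∃ F : Set (Sent P R), F.Finite ∧ F ⊆ Γ ∧ ProvesC F φ := by
  induction h with
  | @hyp Γ φ h =>
    exact ⟨{φ}, Set.finite_singleton _, Set.singleton_subset_iff.2 h, .hyp rfl⟩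
  | ax x => exact ⟨∅, Set.finite_empty, Set.empty_subset _, .ax x⟩
  | barbara _ _ i1 i2 =>
    obtain ⟨F, f1, f2, f3⟩ := i1
    obtain ⟨G, g1, g2, g3⟩ := i2
    exact ⟨F ∪ G, f1.union g1, Set.union_subset f2 g2,
      .barbara (f3.weaken Set.subset_union_left) (g3.weaken Set.subset_union_right)⟩
  | anti r _ i =>
    obtain ⟨F, f1, f2, f3⟩ := i
    exact ⟨F, f1, f2, .anti r f3⟩
  | some1 _ i =>
    obtain ⟨F, f1, f2, f3⟩ := i
    exact ⟨F, f1, f2, .some1 f3⟩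
  | some2 _ i =>
    obtain ⟨F, f1, f2, f3⟩ := i
    exact ⟨F, f1, f2, .some2 f3⟩
  | darii _ _ i1 i2 =>
    obtain ⟨F, f1, f2, f3⟩ := i1
    obtain ⟨G, g1, g2, g3⟩ := i2
    exact ⟨F ∪ G, f1.union g1, Set.union_subset f2 g2,
      .darii (f3.weaken Set.subset_union_left) (g3.weaken Set.subset_union_right)⟩
  | @cases Γ φ x y r _ _ i1 i2 =>
    obtain ⟨F, f1, f2, f3⟩ := i1
    obtain ⟨G, g1, g2, g3⟩ := i2
    refine ⟨(F ∪ G) ∩ Γ, (f1.union g1).inter_of_left _, Set.inter_subset_right,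
      .cases x y r (f3.weaken ?_) (g3.weaken ?_)⟩
    · intro s hs
      rcases f2 hs with h | h
      · exact Or.inl h
      · exact Or.inr ⟨Or.inl hs, h⟩
    · intro s hs
      rcases g2 hs with h | h
      · exact Or.inl h
      · exact Or.inr ⟨Or.inr hs, h⟩

theorem exists_maximal_nonproving {P R : Type} {Γ : Set (Sent P R)} {φ : Sent P R}
    (h : ¬ ProvesC Γ φ) : ∃ Δ, Γ ⊆ Δ ∧ Maximal (fun Δ => ¬ ProvesC Δ φ) Δ := by
  refine zorn_subset_nonempty {Δ | ¬ ProvesC Δ φ} ?_ Γ h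
  intro c hc hch hne
  refine ⟨⋃₀ c, ?_, fun s hs => Set.subset_sUnion_of_mem hs⟩
  intro hp
  obtain ⟨F, f1, f2, f3⟩ := hp.finitary
  obtain ⟨t, ht, hFt⟩ :=
    DirectedOn.exists_mem_subset_of_finite_of_subset_sUnion hne hch.directedOn f1 f2
  exact hc ht (f3.weaken hFt)

/-- The canonical model on a set `D` of pairs of terms. -/
def canon {P R : Type} (Δ : Set (Sent P R)) (D : Set (Tm P R × Tm P R)) : Model P R where
  W := D
  nounI p := {d | ProvesC Δ (.allS d.1.1 (.noun p)) ∨ ProvesC Δ (.allS d.1.2 (.noun p))}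
  verbI r d e := ∃ w, (ProvesC Δ (.allS d.1.1 (.allT r w)) ∨ ProvesC Δ (.allS d.1.2 (.allT r w)))
    ∧ (ProvesC Δ (.allS e.1.1 w) ∨ ProvesC Δ (.allS e.1.2 w))

theorem canon_truth {P R : Type} (Δ : Set (Sent P R)) (D : Set (Tm P R × Tm P R))
    (hD : ∀ x y, ProvesC Δ (.someS x y) → (x, y) ∈ D)
    (hc : ∀ x, ProvesC Δ (.someS x x) ∨ ∀ y r, ProvesC Δ (.allS y (.allT r x)))
    (z : Tm P R) (d : D) : d ∈ Tm.interp (canon Δ D) z ↔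
      (ProvesC Δ (.allS d.1.1 z) ∨ ProvesC Δ (.allS d.1.2 z)) := by
  induction z generalizing d with
  | noun p => exact Iff.rfl
  | allT r w ih =>
    constructor
    · intro h
      rcases hc w with hw | hw
      · have hm := hD w w hw
        obtain ⟨v, h1, h2⟩ := h ⟨(w, w), hm⟩ ((ih ⟨(w, w), hm⟩).2 (Or.inl (.ax w)))
        have h2 : ProvesC Δ (.allS w v) := h2.elim id id
        exact h1.imp (fun h => .barbara h (.anti r h2)) (fun h => .barbara h (.anti r h2))
      · exact Or.inl (hw _ _)
    · intro h e he
      exact ⟨w, h, (ih e).1 he⟩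

theorem canon_sat {P R : Type} (Δ : Set (Sent P R)) (D : Set (Tm P R × Tm P R))
    (hD : ∀ x y, ProvesC Δ (.someS x y) → (x, y) ∈ D)
    (hc : ∀ x, ProvesC Δ (.someS x x) ∨ ∀ y r, ProvesC Δ (.allS y (.allT r x)))
    (ψ : Sent P R) (hψ : ψ ∈ Δ) : (canon Δ D).sat ψ := by
  have T := canon_truth Δ D hD hc
  cases ψ with
  | allS x y =>
    intro d hd
    exact (T y d).2 (((T x d).1 hd).imp (fun h => .barbara h (.hyp hψ))
      (fun h => .barbara h (.hyp hψ)))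
  | someS x y =>
    have hm := hD x y (.hyp hψ)
    exact ⟨⟨(x, y), hm⟩, (T x ⟨(x, y), hm⟩).2 (Or.inl (.ax x)),
      (T y ⟨(x, y), hm⟩).2 (Or.inr (.ax y))⟩

theorem some_of_le {P R : Type} {Δ : Set (Sent P R)} {u v x y : Tm P R}
    (h : ProvesC Δ (.someS u v)) (hx : ProvesC Δ (.allS u x)) (hy : ProvesC Δ (.allS v y)) :
    ProvesC Δ (.someS x y) :=
  .darii (.some2 (.darii (.some2 h) hx)) hy

theorem stmt11 {P R : Type} (Γ : Set (Sent P R)) (φ : Sent P R)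
    (h : entails Γ φ) : ProvesC Γ φ := by
  by_contra hn
  obtain ⟨Δ, hΓ, hmax⟩ := exists_maximal_nonproving hn
  have hins : ∀ s, ¬ ProvesC (insert s Δ) φ → s ∈ Δ := fun s hs =>
    hmax.2 (y := insert s Δ) hs (Set.subset_insert s Δ) (Set.mem_insert s Δ)
  have hc : ∀ x, ProvesC Δ (.someS x x) ∨ ∀ y r, ProvesC Δ (.allS y (.allT r x)) := by
    intro x
    by_cases hx : ProvesC (insert (.someS x x) Δ) φ
    · refine Or.inr fun y r => .hyp (hins _ fun hy => hmax.1 (.cases x y r hx hy))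
    · exact Or.inl (.hyp (hins _ hx))
  have hnot : ¬ ProvesC Δ φ := hmax.1
  cases φ with
  | allS a b =>
    let D : Set (Tm P R × Tm P R) := {d | ProvesC Δ (.someS d.1 d.2) ∨ d = (a, a)}
    have hD : ∀ x y, ProvesC Δ (.someS x y) → (x, y) ∈ D := fun x y h => Or.inl h
    have T := canon_truth Δ D hD hc
    have hs := h (canon Δ D) (fun ψ hψ => canon_sat Δ D hD hc ψ (hΓ hψ))
    have ha : (a, a) ∈ D := Or.inr rfl
    have := (T b ⟨(a, a), ha⟩).1 (hs ((T a ⟨(a, a), ha⟩).2 (Or.inl (.ax a))))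
    exact hnot (this.elim id id)
  | someS a b =>
    let D : Set (Tm P R × Tm P R) := {d | ProvesC Δ (.someS d.1 d.2)}
    have hD : ∀ x y, ProvesC Δ (.someS x y) → (x, y) ∈ D := fun x y h => h
    have T := canon_truth Δ D hD hc
    obtain ⟨d, h1, h2⟩ := h (canon Δ D) (fun ψ hψ => canon_sat Δ D hD hc ψ (hΓ hψ))
    have hd : ProvesC Δ (.someS d.1.1 d.1.2) := d.2
    rcases (T a d).1 h1 with h1 | h1 <;> rcases (T b d).1 h2 with h2 | h2
    · exact hnot (some_of_le (.some1 hd) h1 h2)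
    · exact hnot (some_of_le hd h1 h2)
    · exact hnot (some_of_le (.some2 hd) h1 h2)
    · exact hnot (some_of_le (.some1 (.some2 hd)) h1 h2)
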